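/- Let (W,S) be an irreducible, infinite Coxeter system of finite rank, w ∈ W, and p a positive integer. Then w is essential if and only if w^p is essential. -/

import Mathlib

namespace CoxeterPaper

/-- The Coxeter graph: vertices are the elements of `B`, and `i ≠ j` are adjacent
iff `m i j ≥ 3` (including `m i j = ∞`, encoded as `0`), i.e. iff `m i j ≠ 2`. -/
def coxeterGraph {B : Type*} (M : CoxeterMatrix B) : SimpleGraph B :=
  SimpleGraph.fromRel fun i j => M i j ≠ 2

/-- A Coxeter matrix (system) is irreducible if its Coxeter graph is connected. -/
def IsIrreducible {B : Type*} (M : CoxeterMatrix B) : Prop := (coxeterGraph M).Connected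

/-- A parabolic subgroup of `W` is a subgroup of the form `x W_I x⁻¹` with `x ∈ W`
and `I ⊆ S`, where `W_I` is the (special) subgroup generated by `{s_i : i ∈ I}`. -/
def IsParabolic {B W : Type*} [Group W] {M : CoxeterMatrix B} (cs : CoxeterSystem M W)
    (P : Subgroup W) : Prop :=
  ∃ (x : W) (I : Set B),
    P = Subgroup.map (MulAut.conj x).toMonoidHom (Subgroup.closure (cs.simple '' I))

/-- An element of `W` is essential if it lies in no proper parabolic subgroup. -/
def IsEssential {B W : Type*} [Group W] {M : CoxeterMatrix B} (cs : CoxeterSystem M W)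
    (w : W) : Prop :=
  ∀ P : Subgroup W, IsParabolic cs P → P ≠ ⊤ → w ∉ P

open Module

/-- The simple coroots of the geometric representation on `B →₀ ℝ`. Since `π / 0 = 0`, the
pairing of two generators whose product has infinite order is `-2`. -/
noncomputable def coroot {B : Type*} (M : CoxeterMatrix B) (i : B) : Dual ℝ (B →₀ ℝ) :=
  Finsupp.linearCombination ℝ fun j => -2 * Real.cos (Real.pi / M i j)

section Geometric

variable {B : Type*} (M : CoxeterMatrix B)

theorem coroot_single (i j : B) :
    coroot M i (Finsupp.single j 1) = -2 * Real.cos (Real.pi / M i j) := by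
  simp [coroot]

theorem coroot_single_self (i : B) : coroot M i (Finsupp.single i 1) = 2 := by
  simp [coroot_single]

theorem coroot_symm (i j : B) :
    coroot M i (Finsupp.single j 1) = coroot M j (Finsupp.single i 1) := by
  simp only [coroot_single, M.symmetric i j]

/-- The reflection of `B →₀ ℝ` attached to a simple generator. -/
noncomputable def simpleReflection (i : B) : (B →₀ ℝ) ≃ₗ[ℝ] (B →₀ ℝ) :=
  reflection (coroot_single_self M i)

theorem simpleReflection_apply (i : B) (v : B →₀ ℝ) :
    simpleReflection M i v = v - coroot M i v • Finsupp.single i 1 :=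
  reflection_apply _ _

theorem isLiftable_simpleReflection : M.IsLiftable (simpleReflection M) := by
  intro i j
  by_cases hij : i = j
  · subst hij
    ext1 v
    simp [simpleReflection, involutive_reflection (coroot_single_self M i) v]
  have h1 : M i j ≠ 1 := M.off_diagonal i j hij
  obtain h0 | h2 | h3 : M i j = 0 ∨ M i j = 2 ∨ 3 ≤ M i j := by omega
  · simp [h0]
  · have hi : coroot M i (Finsupp.single j 1) = 0 := by simp [coroot_single, h2]
    have hj : coroot M j (Finsupp.single i 1) = 0 := by rw [coroot_symm, hi]
    rw [h2]
    ext1 v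
    simp only [pow_two, LinearEquiv.mul_apply, simpleReflection_apply, map_sub, map_smul, hi, hj,
      coroot_single_self, LinearEquiv.coe_one, id]
    module
  · have hm : (0 : ℝ) < M i j := by exact_mod_cast (by omega : 0 < M i j)
    have hm3 : (3 : ℝ) ≤ M i j := by exact_mod_cast h3
    set θ : ℝ := 2 * (Real.pi / M i j) with hθ
    have hmθ : (M i j : ℝ) * θ = 2 * Real.pi := by rw [hθ]; field_simp
    have hpos : 0 < θ := by positivity
    have hlt : θ < Real.pi := by nlinarith [Real.pi_pos]
    have hsin : Real.sin θ ≠ 0 := (Real.sin_pos_of_pos_of_lt_pi hpos hlt).ne'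
    have ht : 2 * Real.cos θ =
        coroot M i (Finsupp.single j 1) * coroot M j (Finsupp.single i 1) - 2 := by
      rw [coroot_symm M j i, coroot_single, hθ, Real.cos_two_mul]
      ring
    have hS (n : ℤ) := Polynomial.Chebyshev.S_two_mul_real_cos θ n
    ext1 v
    rw [simpleReflection, simpleReflection,
      reflection_mul_reflection_pow_apply _ _ (M i j) v (2 * Real.cos θ) ht]
    obtain ⟨k, hk | hk⟩ := Nat.even_or_odd' (M i j)
    · have hk' : (k : ℝ) * θ = Real.pi := by
        rw [hk] at hmθ
        push_cast at hmθ
        linarith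
      have e1 : (((M i j : ℕ) : ℤ) - 2) / 2 = k - 1 := by omega
      have e2 : (((M i j : ℕ) : ℤ) - 1) / 2 = k - 1 := by omega
      have hz : (Polynomial.Chebyshev.S ℝ (k - 1)).eval (2 * Real.cos θ) = 0 := by
        have := hS (k - 1)
        push_cast at this
        rw [sub_add_cancel, hk', Real.sin_pi] at this
        exact (mul_eq_zero.mp this).resolve_right hsin
      simp [e1, e2, hz]
    · have hk' : (k : ℝ) * θ + (k + 1) * θ = 2 * Real.pi := by
        rw [hk] at hmθ
        push_cast at hmθ
        linarith
      have e1 : (((M i j : ℕ) : ℤ) - 2) / 2 = k - 1 := by omega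
      have e2 : (((M i j : ℕ) : ℤ) - 1) / 2 = k := by omega
      have e3 : (((M i j : ℕ) : ℤ) - 3) / 2 = k - 1 := by omega
      have e4 : ((M i j : ℕ) : ℤ) / 2 = k := by omega
      have hz : (Polynomial.Chebyshev.S ℝ k).eval (2 * Real.cos θ) +
          (Polynomial.Chebyshev.S ℝ (k - 1)).eval (2 * Real.cos θ) = 0 := by
        refine (mul_eq_zero.mp (?_ : _ * Real.sin θ = 0)).resolve_right hsin
        rw [add_mul, hS, hS]
        push_cast
        rw [sub_add_cancel, eq_sub_of_add_eq' hk', Real.sin_two_pi_sub]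
        ring
      simp [e1, e2, e3, e4, hz]

/-- Coefficients of the roots of a dihedral subgroup in terms of its two simple roots. -/
theorem exists_dihedral_coeff {m : ℕ} (hm : m ≠ 1) :
    ∃ u : ℕ → ℝ, u 0 = 0 ∧ u 1 = 1 ∧
      (∀ k, u (k + 2) = 2 * Real.cos (Real.pi / m) * u (k + 1) - u k) ∧
      ∀ k, (m = 0 ∨ k ≤ m) → 0 ≤ u k := by
  obtain rfl | h0 := eq_or_ne m 0
  · refine ⟨fun k => k, by simp, by simp, fun k => ?_, fun k _ => by positivity⟩
    push_cast
    simp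
    ring
  have hm2 : (2 : ℝ) ≤ m := by exact_mod_cast (by omega : 2 ≤ m)
  set θ : ℝ := Real.pi / m with hθ
  have hmθ : (m : ℝ) * θ = Real.pi := by rw [hθ]; field_simp
  have hpos : 0 < θ := by positivity
  have hlt : θ < Real.pi := by nlinarith
  have hsin := Real.sin_pos_of_pos_of_lt_pi hpos hlt
  refine ⟨fun k => Real.sin (k * θ) / Real.sin θ, by simp, by simp [hsin.ne'], fun k => ?_,
    fun k hk => div_nonneg (Real.sin_nonneg_of_nonneg_of_le_pi (by positivity) ?_) hsin.le⟩
  · have e1 : ((k + 2 : ℕ) : ℝ) * θ = (k + 1 : ℕ) * θ + θ := by push_cast; ring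
    have e2 : (k : ℝ) * θ = (k + 1 : ℕ) * θ - θ := by push_cast; ring
    simp only [e1, e2, Real.sin_add, Real.sin_sub]
    field_simp
    ring
  · rw [← hmθ]
    have : (k : ℝ) ≤ m := by exact_mod_cast hk.resolve_left h0
    gcongr

end Geometric

section Roots

variable {B W : Type*} [Group W] {M : CoxeterMatrix B} (cs : CoxeterSystem M W)

/-- The geometric representation of a Coxeter system. -/
noncomputable def geomRep : W →* ((B →₀ ℝ) ≃ₗ[ℝ] (B →₀ ℝ)) :=
  cs.lift ⟨simpleReflection M, isLiftable_simpleReflection M⟩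

theorem geomRep_simple (i : B) (v : B →₀ ℝ) :
    geomRep cs (cs.simple i) v = v - coroot M i v • Finsupp.single i 1 := by
  rw [geomRep, cs.lift_apply_simple, simpleReflection_apply]

theorem geomRep_mul (w w' : W) (v : B →₀ ℝ) :
    geomRep cs (w * w') v = geomRep cs w (geomRep cs w' v) := by
  rw [map_mul, LinearEquiv.mul_apply]

theorem geomRep_one (v : B →₀ ℝ) : geomRep cs 1 v = v := by simp

theorem geomRep_inv_apply_self (w : W) (v : B →₀ ℝ) : geomRep cs w⁻¹ (geomRep cs w v) = v := by
  rw [← geomRep_mul, inv_mul_cancel, geomRep_one]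

theorem geomRep_apply_inv_self (w : W) (v : B →₀ ℝ) : geomRep cs w (geomRep cs w⁻¹ v) = v := by
  rw [← geomRep_mul, mul_inv_cancel, geomRep_one]

theorem geomRep_simple_self (i : B) :
    geomRep cs (cs.simple i) (Finsupp.single i 1) = -Finsupp.single i 1 := by
  rw [geomRep_simple, coroot_single_self, two_smul]
  abel

theorem geomRep_mul_simple_self (w : W) (i : B) :
    geomRep cs (w * cs.simple i) (Finsupp.single i 1) = -geomRep cs w (Finsupp.single i 1) := by
  rw [geomRep_mul, geomRep_simple_self, map_neg]

theorem geomRep_alternatingWord {i j : B} {u : ℕ → ℝ} (h0 : u 0 = 0) (h1 : u 1 = 1)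
    (hu : ∀ k, u (k + 2) = 2 * Real.cos (Real.pi / M i j) * u (k + 1) - u k) (k : ℕ) :
    geomRep cs (cs.wordProd (CoxeterSystem.alternatingWord i j k)) (Finsupp.single i 1) =
      if Even k then u (k + 1) • Finsupp.single i 1 + u k • Finsupp.single j 1
      else u k • Finsupp.single i 1 + u (k + 1) • Finsupp.single j 1 := by
  have hc : coroot M i (Finsupp.single j 1) = -2 * Real.cos (Real.pi / M i j) :=
    coroot_single M i j
  induction k with
  | zero => simp [CoxeterSystem.alternatingWord, h0, h1]
  | succ k ih =>
    rw [CoxeterSystem.alternatingWord_succ', cs.wordProd_cons, geomRep_mul, ih, hu k]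
    by_cases hk : Even k
    · simp only [hk, if_true, Nat.even_add_one, not_true_eq_false, if_false, geomRep_simple,
        map_add, map_smul, coroot_single_self, coroot_symm M j i, hc]
      module
    · simp only [hk, if_false, Nat.even_add_one, not_false_eq_true, if_true, geomRep_simple,
        map_add, map_smul, coroot_single_self, hc]
      module

/-- If `w` has right descent `j` but not `i`, then `w` is a reduced product of an element with
neither descent and a nonempty proper initial part of the braid word in `i, j`. -/
theorem exists_dihedral_decomposition {w : W} {i j : B} (hi : ¬cs.IsRightDescent w i)
    (hj : cs.IsRightDescent w j) :
    ∃ (v : W) (k : ℕ), w = v * cs.wordProd (CoxeterSystem.alternatingWord i j k) ∧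
      cs.length v < cs.length w ∧ (M i j = 0 ∨ k < M i j) ∧
      ¬cs.IsRightDescent v i ∧ ¬cs.IsRightDescent v j := by
  classical
  let P (k : ℕ) : Prop := ∃ v, w = v * cs.wordProd (CoxeterSystem.alternatingWord i j k) ∧
    cs.length w = cs.length v + k
  have hP1 : P 1 := by
    refine ⟨w * cs.simple j, ?_, (cs.isRightDescent_iff.mp hj).symm⟩
    simp [CoxeterSystem.alternatingWord]
  have hle {k : ℕ} (h : P k) : k ≤ cs.length w := by
    obtain ⟨v, -, h⟩ := h
    omega
  set k := Nat.findGreatest P (cs.length w) with hk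
  have hk1 : 1 ≤ k := Nat.le_findGreatest (hle hP1) hP1
  have hmax : ¬P (k + 1) := fun h => by
    have := Nat.le_findGreatest (hle h) h
    omega
  obtain ⟨v, hv, hlen⟩ : P k := Nat.findGreatest_spec (hle hP1) hP1
  have hword (l : List B) (hl : w = v * cs.wordProd l) : cs.length w ≤ cs.length v + l.length :=
    hl ▸ (cs.length_mul_le _ _).trans (by gcongr; exact cs.length_wordProd_le l)
  have hnext : ¬cs.IsRightDescent v (if Even k then j else i) := fun h => by
    refine hmax ⟨v * cs.simple (if Even k then j else i), ?_, ?_⟩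
    · rw [CoxeterSystem.alternatingWord_succ', cs.wordProd_cons, ← mul_assoc,
        cs.simple_mul_simple_cancel_right, hv]
    · have := cs.isRightDescent_iff.mp h
      omega
  have hfirst : ¬cs.IsRightDescent v (if Even k then i else j) := fun h => by
    obtain ⟨l, hl⟩ : ∃ l, k = l + 1 := ⟨k - 1, by omega⟩
    have hw : w = v * cs.simple (if Even k then i else j) *
        cs.wordProd (CoxeterSystem.alternatingWord i j l) := by
      rw [hv, hl, CoxeterSystem.alternatingWord_succ', cs.wordProd_cons, mul_assoc]
      by_cases hl : Even l <;> simp [hl, Nat.even_add_one]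
    have h1 := cs.length_mul_le (v * cs.simple (if Even k then i else j))
      (cs.wordProd (CoxeterSystem.alternatingWord i j l))
    have h2 := cs.length_wordProd_le (CoxeterSystem.alternatingWord i j l)
    rw [← hw] at h1
    rw [CoxeterSystem.length_alternatingWord] at h2
    have := cs.isRightDescent_iff.mp h
    omega
  refine ⟨v, k, hv, by omega, ?_, ?_⟩
  · by_contra! hcon
    obtain ⟨hM0, hMk⟩ := hcon
    obtain hlt | heq := hMk.lt_or_eq
    · have h1 := cs.not_isReduced_alternatingWord i j hM0 hlt
      have h2 := cs.length_wordProd_le (CoxeterSystem.alternatingWord i j k)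
      have h3 := cs.length_mul_le v (cs.wordProd (CoxeterSystem.alternatingWord i j k))
      rw [CoxeterSystem.IsReduced] at h1
      rw [← hv] at h3
      rw [CoxeterSystem.length_alternatingWord] at h1 h2
      omega
    · obtain ⟨l, hl⟩ : ∃ l, k = l + 1 := ⟨k - 1, by omega⟩
      have hbraid := cs.wordProd_braidWord_eq i j
      rw [CoxeterSystem.braidWord, CoxeterSystem.braidWord, M.symmetric j i, heq, hl,
        CoxeterSystem.alternatingWord_succ j i, cs.wordProd_concat, ← hl] at hbraid
      have hw : w * cs.simple i = v * cs.wordProd (CoxeterSystem.alternatingWord i j l) := by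
        rw [hv, hbraid, ← mul_assoc, cs.simple_mul_simple_cancel_right]
      have h1 := cs.length_mul_le v (cs.wordProd (CoxeterSystem.alternatingWord i j l))
      have h2 := cs.length_wordProd_le (CoxeterSystem.alternatingWord i j l)
      rw [← hw, cs.not_isRightDescent_iff.mp hi] at h1
      rw [CoxeterSystem.length_alternatingWord] at h2
      omega
  · by_cases hk : Even k
    · simp only [hk, if_true] at hfirst hnext
      exact ⟨hfirst, hnext⟩
    · simp only [hk, if_false] at hfirst hnext
      exact ⟨hnext, hfirst⟩

theorem geomRep_single_nonneg {w : W} {i : B} (hi : ¬cs.IsRightDescent w i) :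
    0 ≤ geomRep cs w (Finsupp.single i 1) := by
  induction hn : cs.length w using Nat.strong_induction_on generalizing w i with
  | _ n ih =>
    obtain rfl | hw := eq_or_ne w 1
    · simp
    obtain ⟨j, hj⟩ := cs.exists_rightDescent_of_ne_one hw
    have hij : i ≠ j := fun h => hi (h ▸ hj)
    obtain ⟨v, k, rfl, hlt, hk, hvi, hvj⟩ := exists_dihedral_decomposition cs hi hj
    obtain ⟨u, h0, h1, hu, hpos⟩ := exists_dihedral_coeff (M.off_diagonal i j hij)
    have hi' := ih _ (hn ▸ hlt) hvi rfl
    have hj' := ih _ (hn ▸ hlt) hvj rfl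
    have hk0 : 0 ≤ u k := hpos k (by omega)
    have hk1 : 0 ≤ u (k + 1) := hpos (k + 1) (by omega)
    rw [geomRep_mul, geomRep_alternatingWord cs h0 h1 hu]
    split_ifs <;> simp only [map_add, map_smul] <;>
      exact add_nonneg (smul_nonneg ‹_› hi') (smul_nonneg ‹_› hj')

theorem geomRep_single_nonpos {w : W} {i : B} (hi : cs.IsRightDescent w i) :
    geomRep cs w (Finsupp.single i 1) ≤ 0 := by
  have h := geomRep_single_nonneg cs (cs.isRightDescent_iff_not_isRightDescent_mul.mp hi)
  rwa [geomRep_mul_simple_self, neg_nonneg] at h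

/-- The set of roots of the geometric representation. -/
def roots : Set (B →₀ ℝ) := {β | ∃ w i, β = geomRep cs w (Finsupp.single i 1)}

variable {cs}

theorem single_mem_roots (i : B) : Finsupp.single i 1 ∈ roots cs := ⟨1, i, by simp⟩

theorem geomRep_mem_roots {β : B →₀ ℝ} (hβ : β ∈ roots cs) (w : W) :
    geomRep cs w β ∈ roots cs := by
  obtain ⟨v, i, rfl⟩ := hβ
  exact ⟨w * v, i, by rw [geomRep_mul]⟩

theorem neg_mem_roots {β : B →₀ ℝ} (hβ : β ∈ roots cs) : -β ∈ roots cs := by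
  obtain ⟨v, i, rfl⟩ := hβ
  exact ⟨v * cs.simple i, i, by rw [geomRep_mul_simple_self]⟩

theorem nonneg_or_nonpos_of_mem_roots {β : B →₀ ℝ} (hβ : β ∈ roots cs) : 0 ≤ β ∨ β ≤ 0 := by
  obtain ⟨w, i, rfl⟩ := hβ
  by_cases hi : cs.IsRightDescent w i
  · exact .inr (geomRep_single_nonpos cs hi)
  · exact .inl (geomRep_single_nonneg cs hi)

theorem ne_zero_of_mem_roots {β : B →₀ ℝ} (hβ : β ∈ roots cs) : β ≠ 0 := by
  obtain ⟨w, i, rfl⟩ := hβ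
  simp

variable (M) in
/-- The canonical bilinear form, normalised so that roots have square length `2`. -/
noncomputable def form : (B →₀ ℝ) →ₗ[ℝ] Dual ℝ (B →₀ ℝ) :=
  Finsupp.linearCombination ℝ (coroot M)

theorem form_single_left (i : B) (v : B →₀ ℝ) : form M (Finsupp.single i 1) v = coroot M i v := by
  simp [form]

theorem form_single_right (i : B) (v : B →₀ ℝ) : form M v (Finsupp.single i 1) = coroot M i v := by
  suffices h : (form M).flip (Finsupp.single i 1) = coroot M i from LinearMap.congr_fun h v
  ext j
  simp [form_single_left, coroot_symm M j i]

theorem form_geomRep (w : W) (v : B →₀ ℝ) :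
    form M (geomRep cs w v) (geomRep cs w v) = form M v v := by
  induction w using cs.simple_induction_left with
  | one => simp
  | mul_simple_left w i ih =>
    rw [geomRep_mul, ← ih, geomRep_simple]
    simp only [map_sub, map_smul, LinearMap.sub_apply, LinearMap.smul_apply, form_single_left,
      form_single_right, coroot_single_self, smul_eq_mul]
    ring

theorem form_self_of_mem_roots {β : B →₀ ℝ} (hβ : β ∈ roots cs) : form M β β = 2 := by
  obtain ⟨w, i, rfl⟩ := hβ
  rw [form_geomRep, form_single_left, coroot_single_self]

/-- A simple reflection makes only its own simple root negative. -/
theorem eq_single_of_geomRep_simple_nonpos {β : B →₀ ℝ} (hβ : β ∈ roots cs) (h0 : 0 ≤ β) {i : B}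
    (hi : geomRep cs (cs.simple i) β ≤ 0) : β = Finsupp.single i 1 := by
  have hβi : β = Finsupp.single i (β i) := by
    ext j
    obtain rfl | hj := eq_or_ne i j
    · simp
    · have h := hi j
      rw [geomRep_simple] at h
      simp only [Finsupp.coe_sub, Finsupp.coe_smul, Pi.sub_apply, Pi.smul_apply,
        Finsupp.single_eq_of_ne hj.symm, smul_zero, sub_zero, Finsupp.coe_zero,
        Pi.zero_apply] at h
      rw [Finsupp.single_eq_of_ne hj.symm]
      exact le_antisymm h (h0 j)
  have hc : β = β i • Finsupp.single i (1 : ℝ) := by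
    rw [Finsupp.smul_single_one]
    exact hβi
  have hform := form_self_of_mem_roots hβ
  have hi0 : 0 ≤ β i := h0 i
  rw [hc] at hform
  simp only [map_smul, LinearMap.smul_apply, form_single_left, coroot_single_self,
    smul_eq_mul] at hform
  have : β i = 1 := by nlinarith
  rw [hβi, this]

theorem finite_inversions (w : W) :
    {β | β ∈ roots cs ∧ 0 ≤ β ∧ geomRep cs w β ≤ 0}.Finite := by
  induction w using cs.simple_induction_left with
  | one =>
    refine Set.finite_empty.subset fun β hβ => ?_
    obtain ⟨hr, h0, h1⟩ := hβ
    rw [geomRep_one] at h1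
    exact ne_zero_of_mem_roots hr (le_antisymm h1 h0)
  | mul_simple_left w i ih =>
    refine (ih.insert (geomRep cs w⁻¹ (Finsupp.single i 1))).subset fun β hβ => ?_
    obtain ⟨hr, h0, h1⟩ := hβ
    obtain h | h := nonneg_or_nonpos_of_mem_roots (geomRep_mem_roots hr w)
    · left
      rw [geomRep_mul] at h1
      rw [← eq_single_of_geomRep_simple_nonpos (geomRep_mem_roots hr w) h h1,
        geomRep_inv_apply_self]
    · exact .inr ⟨hr, h0, h⟩

theorem eq_one_of_geomRep_single {w : W}
    (h : ∀ i, geomRep cs w (Finsupp.single i 1) = Finsupp.single i 1) : w = 1 := by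
  by_contra hw
  obtain ⟨i, hi⟩ := cs.exists_rightDescent_of_ne_one hw
  have h1 := geomRep_single_nonpos cs hi i
  rw [h] at h1
  norm_num at h1

theorem infinite_roots [Finite B] [Infinite W] : (roots cs).Infinite := by
  intro hfin
  have := hfin.to_subtype
  let f (w : W) (i : B) : roots cs := ⟨geomRep cs w (Finsupp.single i 1), w, i, rfl⟩
  refine not_injective_infinite_finite f fun w w' h => ?_
  refine inv_mul_eq_one.mp (eq_one_of_geomRep_single (cs := cs) fun i => ?_)
  have hi : geomRep cs w (Finsupp.single i 1) = geomRep cs w' (Finsupp.single i 1) :=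
    congrArg Subtype.val (congrFun h i)
  rw [geomRep_mul, ← hi, geomRep_inv_apply_self]

/-- In an irreducible infinite Coxeter group, a nonzero functional is nonzero on infinitely
many roots. -/
theorem eq_zero_of_finite_roots_ne_zero [Finite B] [Infinite W] (hirr : IsIrreducible M)
    {x : Dual ℝ (B →₀ ℝ)} (hx : {β | β ∈ roots cs ∧ x β ≠ 0}.Finite) : x = 0 := by
  let L : Submodule ℝ (Dual ℝ (B →₀ ℝ)) :=
    { carrier := {x | {β | β ∈ roots cs ∧ x β ≠ 0}.Finite}
      zero_mem' := by simp
      add_mem' := fun {x y} hx hy => (hx.union hy).subset fun β hβ => by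
        by_contra! hcon
        simp only [Set.mem_union, Set.mem_ofPred_eq, not_or, not_and, not_not] at hcon
        exact hβ.2 (by simp [hcon.1 hβ.1, hcon.2 hβ.1])
      smul_mem' := fun c x hx => hx.subset fun β hβ =>
        ⟨hβ.1, fun h => hβ.2 (by simp [h])⟩ }
  have hL {x : Dual ℝ (B →₀ ℝ)} (hx : x ∈ L) (w : W) :
      x ∘ₗ (geomRep cs w : (B →₀ ℝ) →ₗ[ℝ] (B →₀ ℝ)) ∈ L := by
    refine (Set.Finite.image (geomRep cs w⁻¹) hx).subset fun β hβ => ?_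
    exact ⟨geomRep cs w β, ⟨geomRep_mem_roots hβ.1 w, hβ.2⟩, geomRep_inv_apply_self cs w β⟩
  obtain ⟨s, hs⟩ := (IsNoetherian.noetherian L : L.FG)
  have hbad : (⋃ y ∈ s, {β | β ∈ roots cs ∧ y β ≠ 0}).Finite :=
    s.finite_toSet.biUnion fun y hy => (hs ▸ Submodule.subset_span hy : y ∈ L)
  obtain ⟨β, hβ, hβs⟩ := (infinite_roots (cs := cs)).exists_notMem_finite hbad
  have hβL : ∀ y ∈ L, y β = 0 := by
    intro y hy
    rw [← hs] at hy
    induction hy using Submodule.span_induction with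
    | mem y hy =>
      by_contra h
      exact hβs (Set.mem_biUnion hy ⟨hβ, h⟩)
    | zero => rfl
    | add y z _ _ hy hz => simp [hy, hz]
    | smul c y _ hy => simp [hy]
  obtain ⟨w, i, rfl⟩ := hβ
  have hbase : ∀ y ∈ L, y (Finsupp.single i 1) = 0 := fun y hy => by
    have := hβL _ (hL hy w⁻¹)
    rwa [LinearMap.comp_apply, LinearEquiv.coe_coe, geomRep_inv_apply_self] at this
  have hstep {j k : B} (hjk : (coxeterGraph M).Adj j k)
      (hj : ∀ y ∈ L, y (Finsupp.single j 1) = 0) : ∀ y ∈ L, y (Finsupp.single k 1) = 0 := by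
    intro y hy
    have h := hj _ (hL hy (cs.simple k))
    rw [LinearMap.comp_apply, LinearEquiv.coe_coe, geomRep_simple, map_sub, hj y hy, map_smul,
      zero_sub, neg_eq_zero, smul_eq_mul, coroot_single] at h
    refine (mul_eq_zero.mp h).resolve_left ?_
    obtain ⟨hne, hM⟩ := (SimpleGraph.fromRel_adj _ _ _).mp hjk
    rw [M.symmetric j k, or_self] at hM
    have h1 := M.off_diagonal k j hne.symm
    have hcos : 0 < Real.cos (Real.pi / M k j) := by
      obtain h0 | h3 : M k j = 0 ∨ 3 ≤ M k j := by omega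
      · simp [h0]
      · have h3' : (3 : ℝ) ≤ M k j := by exact_mod_cast h3
        have hpi := Real.pi_pos
        refine Real.cos_pos_of_mem_Ioo ⟨?_, ?_⟩
        · have : 0 < Real.pi / M k j := by positivity
          linarith
        · gcongr
          linarith
    nlinarith
  have hwalk {j k : B} (p : (coxeterGraph M).Walk j k)
      (hj : ∀ y ∈ L, y (Finsupp.single j 1) = 0) : ∀ y ∈ L, y (Finsupp.single k 1) = 0 := by
    induction p with
    | nil => exact hj
    | cons hadj _ ih => exact ih (hstep hadj hj)
  ext k
  obtain ⟨p⟩ := hirr.preconnected i k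
  simpa using hwalk p hbase x hx

end Roots

section Parabolic

variable {B W : Type*} [Group W] {M : CoxeterMatrix B} {cs : CoxeterSystem M W}

theorem not_isEssential_iff {w : W} :
    ¬IsEssential cs w ↔ ∃ (g : W) (I : Set B), Subgroup.closure (cs.simple '' I) ≠ ⊤ ∧
      g⁻¹ * w * g ∈ Subgroup.closure (cs.simple '' I) := by
  have hmem (g h : W) (H : Subgroup W) :
      h ∈ H.map (MulAut.conj g).toMonoidHom ↔ g⁻¹ * h * g ∈ H := by
    constructor
    · rintro ⟨a, ha, rfl⟩
      simpa [mul_assoc] using ha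
    · exact fun hh => ⟨_, hh, by simp [mul_assoc]⟩
  have htop (g : W) (H : Subgroup W) : H.map (MulAut.conj g).toMonoidHom = ⊤ ↔ H = ⊤ := by
    constructor
    · intro h
      refine eq_top_iff.mpr fun a _ => ?_
      have ha : g * a * g⁻¹ ∈ H.map (MulAut.conj g).toMonoidHom := h ▸ Subgroup.mem_top _
      simpa [hmem, mul_assoc] using ha
    · rintro rfl
      exact Subgroup.map_top_of_surjective _ (MulAut.conj g).surjective
  simp only [IsEssential, IsParabolic]
  push Not
  constructor
  · rintro ⟨_, ⟨g, I, rfl⟩, hP, hw⟩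
    exact ⟨g, I, fun h => hP ((htop _ _).mpr h), (hmem _ _ _).mp hw⟩
  · rintro ⟨g, I, hI, hw⟩
    exact ⟨_, ⟨g, I, rfl⟩, fun h => hI ((htop _ _).mp h), (hmem _ _ _).mpr hw⟩

theorem geomRep_apply_of_mem_closure {I : Set B} {x : Dual ℝ (B →₀ ℝ)}
    (hx : ∀ i ∈ I, x (Finsupp.single i 1) = 0) {w : W}
    (hw : w ∈ Subgroup.closure (cs.simple '' I)) (v : B →₀ ℝ) : x (geomRep cs w v) = x v := by
  induction hw using Subgroup.closure_induction generalizing v with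
  | mem w hw =>
    obtain ⟨i, hi, rfl⟩ := hw
    rw [geomRep_simple, map_sub, map_smul, hx i hi, smul_zero, sub_zero]
  | one => rw [geomRep_one]
  | mul a b _ _ ha hb => rw [geomRep_mul, ha, hb]
  | inv a _ ha => rw [← ha, geomRep_apply_inv_self]

theorem apply_nonneg_of_dominant {x : Dual ℝ (B →₀ ℝ)} (hx : ∀ i, 0 ≤ x (Finsupp.single i 1))
    {v : B →₀ ℝ} (hv : 0 ≤ v) : 0 ≤ x v := by
  rw [← v.sum_single, Finsupp.sum, map_sum]
  refine Finset.sum_nonneg fun i _ => ?_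
  rw [← Finsupp.smul_single_one, map_smul]
  exact mul_nonneg (hv i) (hx i)

/-- The stabiliser of a point of the closed fundamental chamber is a standard parabolic. -/
theorem mem_closure_of_dominant_of_fixed {x : Dual ℝ (B →₀ ℝ)}
    (hx : ∀ i, 0 ≤ x (Finsupp.single i 1)) {w : W} (hw : ∀ v, x (geomRep cs w v) = x v) :
    w ∈ Subgroup.closure (cs.simple '' {i | x (Finsupp.single i 1) = 0}) := by
  induction hn : cs.length w using Nat.strong_induction_on generalizing w with
  | _ n ih =>
    obtain rfl | hw1 := eq_or_ne w 1
    · exact one_mem _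
    obtain ⟨i, hi⟩ := cs.exists_rightDescent_of_ne_one hw1
    have hxi : x (Finsupp.single i 1) = 0 := by
      refine le_antisymm ?_ (hx i)
      have h := apply_nonneg_of_dominant hx (neg_nonneg.mpr (geomRep_single_nonpos cs hi))
      rw [map_neg, hw] at h
      linarith
    have hmem := Subgroup.subset_closure (G := W)
      (Set.mem_image_of_mem cs.simple
        (show i ∈ {i | x (Finsupp.single i 1) = 0} from hxi))
    have hlt : cs.length (w * cs.simple i) < n := hn ▸ hi
    have h := ih _ hlt (w := w * cs.simple i) (fun v => by
      rw [geomRep_mul, hw, geomRep_simple, map_sub, map_smul, hxi, smul_zero, sub_zero]) rfl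
    simpa using mul_mem h hmem

/-- An element fixing a nonzero point of the Tits cone is not essential. -/
theorem not_isEssential_of_fixed {y : Dual ℝ (B →₀ ℝ)} (hy : y ≠ 0)
    (hfin : {β | β ∈ roots cs ∧ 0 ≤ β ∧ y β < 0}.Finite) {w : W}
    (hw : ∀ v, y (geomRep cs w v) = y v) : ¬IsEssential cs w := by
  induction hn : {β | β ∈ roots cs ∧ 0 ≤ β ∧ y β < 0}.ncard using Nat.strong_induction_on
    generalizing y w with
  | _ n ih =>
    rw [not_isEssential_iff]
    by_cases hdom : ∀ i, 0 ≤ y (Finsupp.single i 1)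
    · refine ⟨1, {i | y (Finsupp.single i 1) = 0}, fun htop => hy ?_, ?_⟩
      · ext i
        have h := geomRep_apply_of_mem_closure (cs := cs) (fun i hi => hi)
          (htop ▸ Subgroup.mem_top (cs.simple i)) (Finsupp.single i 1)
        rw [geomRep_simple_self, map_neg] at h
        simp only [LinearMap.comp_apply, Finsupp.lsingle_apply, LinearMap.zero_apply]
        linarith
      · simpa using mem_closure_of_dominant_of_fixed hdom hw
    push Not at hdom
    obtain ⟨i, hi⟩ := hdom
    let y' := y ∘ₗ (geomRep cs (cs.simple i) : (B →₀ ℝ) →ₗ[ℝ] (B →₀ ℝ))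
    have hy'_apply (v : B →₀ ℝ) : y' v = y (geomRep cs (cs.simple i) v) := rfl
    have hinv (v : B →₀ ℝ) : geomRep cs (cs.simple i) (geomRep cs (cs.simple i) v) = v := by
      rw [← geomRep_mul, cs.simple_mul_simple_self, geomRep_one]
    have hsub : geomRep cs (cs.simple i) '' {β | β ∈ roots cs ∧ 0 ≤ β ∧ y' β < 0} ⊂
        {β | β ∈ roots cs ∧ 0 ≤ β ∧ y β < 0} := by
      refine (Set.ssubset_iff_of_subset ?_).mpr ⟨Finsupp.single i 1,
        ⟨single_mem_roots i, by simp, hi⟩, ?_⟩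
      · rintro _ ⟨β, ⟨hr, h0, hlt⟩, rfl⟩
        refine ⟨geomRep_mem_roots hr _, ?_, hlt⟩
        refine (nonneg_or_nonpos_of_mem_roots (geomRep_mem_roots hr _)).resolve_right fun h => ?_
        rw [eq_single_of_geomRep_simple_nonpos hr h0 h, hy'_apply, geomRep_simple_self,
          map_neg] at hlt
        linarith
      · rintro ⟨β, ⟨hr, h0, -⟩, hβ⟩
        have h : β = -Finsupp.single i 1 := by
          rw [← hinv β, hβ, geomRep_simple_self]
        rw [h] at h0
        have := h0 i
        norm_num at this
    have hinj : Function.Injective (geomRep cs (cs.simple i)) := (geomRep cs _).injective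
    have hcard := Set.ncard_lt_ncard hsub hfin
    rw [Set.ncard_image_of_injective _ hinj, hn] at hcard
    have hfin' := Set.Finite.of_finite_image (hfin.subset hsub.subset) hinj.injOn
    have hy' : y' ≠ 0 := fun h => hy <| LinearMap.ext fun v => by
      rw [← hinv v, ← hy'_apply, h]
      simp
    have h := ih _ hcard hy' hfin' (w := cs.simple i * w * cs.simple i) (fun v => by
      rw [hy'_apply, hy'_apply, geomRep_mul, geomRep_mul, hinv, hw]) rfl
    obtain ⟨g, I, hI, hg⟩ := not_isEssential_iff.mp h
    refine ⟨cs.simple i * g, I, hI, ?_⟩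
    simpa [mul_assoc] using hg

theorem IsEssential.pow [Finite B] [Infinite W] (hirr : IsIrreducible M) {w : W}
    (hw : IsEssential cs w) {p : ℕ} (hp : 0 < p) : IsEssential cs (w ^ p) := by
  by_contra hwp
  obtain ⟨g, I, hI, hg⟩ := not_isEssential_iff.mp hwp
  obtain ⟨i₀, hi₀⟩ : ∃ i, i ∉ I := by
    by_contra! h
    exact hI (by rw [Set.eq_univ_of_forall h, Set.image_univ, cs.subgroup_closure_range_simple])
  let x : Dual ℝ (B →₀ ℝ) := Finsupp.lapply i₀
  let y : Dual ℝ (B →₀ ℝ) := ∑ k ∈ Finset.range p,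
    x ∘ₗ (geomRep cs (g⁻¹ * w ^ k) : (B →₀ ℝ) →ₗ[ℝ] (B →₀ ℝ))
  have hy_apply (v : B →₀ ℝ) : y v = ∑ k ∈ Finset.range p, x (geomRep cs (g⁻¹ * w ^ k) v) := by
    simp [y]
  have hxI : ∀ i ∈ I, x (Finsupp.single i 1) = 0 := fun i hi => by
    have : i₀ ≠ i := fun h => hi₀ (h ▸ hi)
    simp [x, this]
  have hfixed (v : B →₀ ℝ) : y (geomRep cs w v) = y v := by
    have hlast : x (geomRep cs (g⁻¹ * w ^ p) v) = x (geomRep cs g⁻¹ v) := by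
      rw [← geomRep_apply_of_mem_closure hxI hg (geomRep cs g⁻¹ v), ← geomRep_mul]
      simp
    obtain ⟨q, rfl⟩ : ∃ q, p = q + 1 := ⟨p - 1, by omega⟩
    rw [hy_apply, hy_apply, Finset.sum_range_succ, Finset.sum_range_succ']
    simp only [← geomRep_mul, mul_assoc, ← pow_succ, hlast, pow_zero, mul_one]
  let N (k : ℕ) : Set (B →₀ ℝ) := {β | β ∈ roots cs ∧ 0 ≤ β ∧ geomRep cs (g⁻¹ * w ^ k) β ≤ 0}
  have hN : (⋃ k ∈ Finset.range p, N k).Finite :=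
    (Finset.range p).finite_toSet.biUnion fun k _ => finite_inversions _
  have hterm {β : B →₀ ℝ} (hr : β ∈ roots cs) (h0 : 0 ≤ β) (hβ : β ∉ ⋃ k ∈ Finset.range p, N k) :
      ∀ k ∈ Finset.range p, 0 ≤ x (geomRep cs (g⁻¹ * w ^ k) β) := by
    intro k hk
    obtain h | h := nonneg_or_nonpos_of_mem_roots (geomRep_mem_roots hr (g⁻¹ * w ^ k))
    · exact h i₀
    · exact absurd (Set.mem_biUnion hk (show β ∈ N k from ⟨hr, h0, h⟩)) hβ
  obtain hy | hy := ne_or_eq y 0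
  · refine not_isEssential_of_fixed hy (hN.subset fun β hβ => ?_) hfixed hw
    obtain ⟨hr, h0, hlt⟩ := hβ
    by_contra hβ
    refine hlt.not_ge ?_
    rw [hy_apply]
    exact Finset.sum_nonneg (hterm hr h0 hβ)
  · let z : Dual ℝ (B →₀ ℝ) := x ∘ₗ (geomRep cs g⁻¹ : (B →₀ ℝ) →ₗ[ℝ] (B →₀ ℝ))
    have hpos {β : B →₀ ℝ} (hr : β ∈ roots cs) (h0 : 0 ≤ β) (hβ : z β ≠ 0) :
        β ∈ ⋃ k ∈ Finset.range p, N k := by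
      by_contra hβN
      have hsum := hy_apply β
      rw [hy, LinearMap.zero_apply, eq_comm,
        Finset.sum_eq_zero_iff_of_nonneg (hterm hr h0 hβN)] at hsum
      refine hβ ?_
      simpa [z] using hsum 0 (Finset.mem_range.mpr hp)
    have hz : z = 0 := by
      refine eq_zero_of_finite_roots_ne_zero (cs := cs) hirr
        ((hN.union (hN.image Neg.neg)).subset fun β hβ => ?_)
      obtain ⟨hr, hβ⟩ := hβ
      obtain h0 | h0 := nonneg_or_nonpos_of_mem_roots hr
      · exact .inl (hpos hr h0 hβ)
      · exact .inr ⟨-β, hpos (neg_mem_roots hr) (neg_nonneg.mpr h0)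
          (by simpa using hβ), neg_neg β⟩
    have h1 : z (geomRep cs g (Finsupp.single i₀ 1)) = 1 := by
      simp only [z, LinearMap.comp_apply, LinearEquiv.coe_coe, geomRep_inv_apply_self]
      simp [x]
    simp [hz] at h1

end Parabolic

/-- In an irreducible, infinite Coxeter group, `w` is essential if
and only if `w^p` is essential, for any positive integer `p`. -/
theorem isEssential_iff_isEssential_pow
    {B W : Type*} [Fintype B] [Group W] {M : CoxeterMatrix B} (cs : CoxeterSystem M W)
    (hirr : IsIrreducible M) (hinf : Infinite W) (w : W) (p : ℕ) (hp : 0 < p) :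
    IsEssential cs w ↔ IsEssential cs (w ^ p) := by
  refine ⟨fun h => h.pow hirr hp, fun h P hP htop hw => ?_⟩
  exact h P hP htop (pow_mem hw p)

end CoxeterPaper
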